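/- Let Σ_5 act on the lattice M by permuting the basis elements e_1,...,e_5 and fixing l'. Then the composition Σ_5 → O(M) → O(q_M) is an isomorphism onto the group O(q_M) of automorphisms of the discriminant group A_M preserving the finite quadratic form q_M. -/

import Mathlib

open Matrix BigOperators

/-- Gram matrix of the rank 6 lattice `M` with basis `l', e₁, …, e₅`:
`l'² = eᵢ² = -2`, `l'·eᵢ = 1`, `eᵢ·eⱼ = 0` for `i ≠ j`.
Index `0` corresponds to `l'` and index `i.succ` to `eᵢ`. -/
def Mgram : Matrix (Fin 6) (Fin 6) ℤ :=
  fun i j => if i = j then -2 else if i = 0 ∨ j = 0 then 1 else 0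

/-- The bilinear form of the lattice `M`. -/
def bM (x y : Fin 6 → ℤ) : ℤ := x ⬝ᵥ (Mgram.mulVec y)

/-- The basis vector `l'`. -/
def lvec : Fin 6 → ℤ := fun j => if j = 0 then 1 else 0

/-- The basis vector `eᵢ`. -/
def ev (i : Fin 5) : Fin 6 → ℤ := fun j => if j = i.succ then 1 else 0

/-- The element `h = 2l' + e₁ + ⋯ + e₅`. -/
def hv : Fin 6 → ℤ := fun j => if j = 0 then 2 else 1

/-- The ℚ-valued bilinear form attached to an integral Gram matrix `A`. -/
def gq {n : ℕ} (A : Matrix (Fin n) (Fin n) ℤ) (y z : Fin n → ℚ) : ℚ :=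
  y ⬝ᵥ ((A.map (Int.cast : ℤ → ℚ)).mulVec z)

lemma gq_add_left {n : ℕ} (A : Matrix (Fin n) (Fin n) ℤ) (y y' z : Fin n → ℚ) :
    gq A (y + y') z = gq A y z + gq A y' z := by
  simp [gq, add_dotProduct]

lemma gq_zsmul_left {n : ℕ} (A : Matrix (Fin n) (Fin n) ℤ) (c : ℤ) (y z : Fin n → ℚ) :
    gq A (c • y) z = (c : ℚ) * gq A y z := by
  rw [gq, smul_dotProduct, zsmul_eq_mul]; rfl

/-- The dual lattice `L* = {y ∈ L ⊗ ℚ : y·x ∈ ℤ for all x ∈ L}` of the lattice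
with Gram matrix `A`, as a ℤ-submodule of `ℚⁿ`. -/
def dualL {n : ℕ} (A : Matrix (Fin n) (Fin n) ℤ) : Submodule ℤ (Fin n → ℚ) where
  carrier := {y | ∀ x : Fin n → ℤ, ∃ m : ℤ, gq A y (fun i => (x i : ℚ)) = (m : ℚ)}
  add_mem' := by
    intro a b ha hb x
    obtain ⟨m1, h1⟩ := ha x
    obtain ⟨m2, h2⟩ := hb x
    exact ⟨m1 + m2, by rw [gq_add_left, h1, h2]; push_cast; ring⟩
  zero_mem' := by
    intro x
    exact ⟨0, by simp [gq]⟩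
  smul_mem' := by
    intro c a ha x
    obtain ⟨m, h⟩ := ha x
    exact ⟨c * m, by rw [gq_zsmul_left, h]; push_cast; ring⟩

/-- The lattice `L = ℤⁿ` sitting inside `ℚⁿ` (spanned by the standard basis). -/
def stdL (n : ℕ) : Submodule ℤ (Fin n → ℚ) :=
  Submodule.span ℤ (Set.range fun i : Fin n => fun j => if j = i then (1 : ℚ) else 0)

/-- The discriminant group `A_L = L*/L` of the lattice with Gram matrix `A`. -/
abbrev discG {n : ℕ} (A : Matrix (Fin n) (Fin n) ℤ) :=
  (dualL A) ⧸ (Submodule.comap (dualL A).subtype (stdL n))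

/-- The discriminant group of `M`. -/
abbrev AM := discG Mgram

/-- An automorphism `τ` of `A_M` preserves the finite quadratic form
`q_M : A_M → ℚ/2ℤ` if for every `y ∈ M*` there is a representative `z ∈ M*`
of `τ([y])` with `z·z ≡ y·y (mod 2ℤ)`. -/
def PreservesQ (τ : AM ≃+ AM) : Prop :=
  ∀ y : dualL Mgram, ∃ z : dualL Mgram,
    Submodule.Quotient.mk z = τ (Submodule.Quotient.mk y) ∧
    ∃ m : ℤ, gq Mgram (z : Fin 6 → ℚ) (z : Fin 6 → ℚ) -
      gq Mgram (y : Fin 6 → ℚ) (y : Fin 6 → ℚ) = 2 * m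

/-- The permutation of `Fin 6 = {l', e₁, …, e₅}` fixing the index `0` (the
basis vector `l'`) and acting by `σ` on the indices `1, …, 5` (the basis
vectors `e₁, …, e₅`). -/
def extPerm (σ : Equiv.Perm (Fin 5)) : Equiv.Perm (Fin 6) :=
  (finSuccEquiv 5).symm.permCongr σ.optionCongr

/-- `τ : A_M ≃+ A_M` is induced by the isometry of `M` permuting the basis
vectors `e₁, …, e₅` by `σ` (and fixing `l'`): for every `y ∈ M*`, the class
`τ([y])` is represented by the coordinate-permuted vector `y ∘ extPerm σ`. -/
def InducedByPerm (σ : Equiv.Perm (Fin 5)) (τ : AM ≃+ AM) : Prop :=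
  ∀ y : dualL Mgram, ∃ z : dualL Mgram,
    ((z : Fin 6 → ℚ) = fun j => (y : Fin 6 → ℚ) (extPerm σ j)) ∧
    τ (Submodule.Quotient.mk y) = Submodule.Quotient.mk z

lemma gq_Mgram (y z : Fin 6 → ℚ) :
    gq Mgram y z = z 0 * (-2 * y 0 + ∑ i : Fin 5, y i.succ) +
      ∑ i : Fin 5, z i.succ * (y 0 - 2 * y i.succ) := by
  have h₁ (i : Fin 5) : Mgram 0 i.succ = 1 := by simp [Mgram, (Fin.succ_ne_zero i).symm]
  have h₂ (i : Fin 5) : Mgram i.succ 0 = 1 := by simp [Mgram]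
  have h₃ (i j : Fin 5) : Mgram i.succ j.succ = if i = j then -2 else 0 := by simp [Mgram]
  have h₄ : Mgram 0 0 = -2 := rfl
  simp only [gq, dotProduct, mulVec, Fin.sum_univ_succ (n := 5), map_apply, h₁, h₂, h₃, h₄]
  simp [mul_add, mul_sub, Finset.sum_add_distrib, Finset.sum_sub_distrib, Finset.mul_sum,
    mul_comm, mul_left_comm]
  ring

lemma mem_dualL_Mgram {y : Fin 6 → ℚ} :
    y ∈ dualL Mgram ↔ ∃ (a c : ℤ) (b : Fin 5 → ℤ),
      y 0 = a ∧ (∀ i : Fin 5, y i.succ = b i / 2) ∧ ∑ i, b i = 2 * c := by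
  constructor
  · intro h
    obtain ⟨n, hn⟩ := h lvec
    choose m hm using fun i : Fin 5 => h (ev i)
    simp only [gq_Mgram, lvec, ev] at hn hm
    simp only [Fin.succ_ne_zero, if_true, if_false, Int.cast_one, Int.cast_zero, one_mul, zero_mul,
      Finset.sum_const_zero, add_zero] at hn
    have hm' (i : Fin 5) : y 0 - 2 * y i.succ = m i := by
      rw [← hm i]
      simp [(Fin.succ_ne_zero i).symm]
    have hsum : y 0 = ((2 * n + ∑ i, m i : ℤ) : ℚ) := by
      push_cast
      simp only [← hm', ← hn, Finset.sum_sub_distrib, ← Finset.mul_sum]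
      simp
      ring
    refine ⟨_, n + 2 * (2 * n + ∑ i, m i), fun i => 2 * n + ∑ i, m i - m i, hsum,
      fun i => ?_, ?_⟩
    · push_cast
      push_cast at hsum
      linarith [hm' i]
    · simp only [Finset.sum_sub_distrib]
      simp
      ring
  · rintro ⟨a, c, b, ha, hb, hc⟩ x
    refine ⟨x 0 * (-2 * a + c) + ∑ i : Fin 5, x i.succ * (a - b i), ?_⟩
    have hc' : ∑ i, (b i : ℚ) = 2 * c := by exact_mod_cast hc
    simp only [gq_Mgram, ha, hb, ← Finset.sum_div, hc']
    push_cast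
    congr 2
    · ring
    · ext i
      ring

lemma mem_stdL {n : ℕ} {y : Fin n → ℚ} : y ∈ stdL n ↔ ∀ i, ∃ m : ℤ, y i = m := by
  constructor
  · intro h
    induction h using Submodule.span_induction with
    | mem x hx =>
      obtain ⟨i, rfl⟩ := hx
      exact fun j => ⟨if j = i then 1 else 0, by push_cast; rfl⟩
    | zero => exact fun _ => ⟨0, by simp⟩
    | add x y _ _ hx hy =>
      intro i
      obtain ⟨k, hk⟩ := hx i
      obtain ⟨l, hl⟩ := hy i
      exact ⟨k + l, by simp [hk, hl]⟩
    | smul c x _ hx =>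
      intro i
      obtain ⟨k, hk⟩ := hx i
      exact ⟨c * k, by simp [hk]⟩
  · intro h
    choose m hm using h
    have hy : y = ∑ i, m i • fun j => if j = i then (1 : ℚ) else 0 := by
      ext j
      simp [hm]
    rw [hy]
    exact Submodule.sum_mem _ fun i _ =>
      Submodule.smul_mem _ _ (Submodule.subset_span ⟨i, rfl⟩)

lemma AM_mk_eq_mk {y z : dualL Mgram} :
    (Submodule.Quotient.mk y : AM) = Submodule.Quotient.mk z ↔
      ∀ i, ∃ m : ℤ, (y : Fin 6 → ℚ) i - (z : Fin 6 → ℚ) i = m := by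
  rw [Submodule.Quotient.eq, Submodule.mem_comap, mem_stdL]
  rfl

@[simp] lemma extPerm_zero (σ : Equiv.Perm (Fin 5)) : extPerm σ 0 = 0 := by
  simp [extPerm, Equiv.permCongr_apply]

@[simp] lemma extPerm_succ (σ : Equiv.Perm (Fin 5)) (i : Fin 5) :
    extPerm σ i.succ = (σ i).succ := by
  simp [extPerm, Equiv.permCongr_apply]

lemma extPerm_symm (σ : Equiv.Perm (Fin 5)) : (extPerm σ).symm = extPerm σ.symm :=
  rfl

lemma comp_extPerm_mem_dualL (σ : Equiv.Perm (Fin 5)) {y : Fin 6 → ℚ} (hy : y ∈ dualL Mgram) :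
    y ∘ extPerm σ ∈ dualL Mgram := by
  obtain ⟨a, c, b, ha, hb, hc⟩ := mem_dualL_Mgram.1 hy
  exact mem_dualL_Mgram.2 ⟨a, c, b ∘ σ, by simp [ha], by simp [hb],
    by rw [← hc]; exact Equiv.sum_comp σ b⟩

lemma gq_comp_extPerm (σ : Equiv.Perm (Fin 5)) (y : Fin 6 → ℚ) :
    gq Mgram (y ∘ extPerm σ) (y ∘ extPerm σ) = gq Mgram y y := by
  simp only [gq_Mgram, Function.comp_apply, extPerm_zero, extPerm_succ]
  rw [Equiv.sum_comp σ fun i => y i.succ,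
    Equiv.sum_comp σ fun i => y i.succ * (y 0 - 2 * y i.succ)]

/-- The automorphism of `M*` permuting coordinates by `σ`. -/
def dualPerm (σ : Equiv.Perm (Fin 5)) : dualL Mgram ≃ₗ[ℤ] dualL Mgram where
  toFun y := ⟨y ∘ extPerm σ, comp_extPerm_mem_dualL σ y.2⟩
  invFun y := ⟨y ∘ extPerm σ.symm, comp_extPerm_mem_dualL σ.symm y.2⟩
  map_add' _ _ := rfl
  map_smul' _ _ := rfl
  left_inv y := by
    ext i
    simp [← extPerm_symm]
  right_inv y := by
    ext i
    simp [← extPerm_symm]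

lemma map_dualPerm (σ : Equiv.Perm (Fin 5)) :
    (Submodule.comap (dualL Mgram).subtype (stdL 6)).map (dualPerm σ : dualL Mgram →ₗ[ℤ] _) =
      Submodule.comap (dualL Mgram).subtype (stdL 6) := by
  ext y
  rw [Submodule.mem_map_equiv]
  simp only [Submodule.mem_comap, mem_stdL]
  exact (extPerm σ.symm).forall_congr_left.trans (by simp [dualPerm])

/-- The automorphism of `A_M` induced by the permutation `σ`. -/
def discPerm (σ : Equiv.Perm (Fin 5)) : AM ≃+ AM :=
  (Submodule.Quotient.equiv _ _ (dualPerm σ) (map_dualPerm σ)).toAddEquiv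

lemma discPerm_mk (σ : Equiv.Perm (Fin 5)) (y : dualL Mgram) :
    discPerm σ (Submodule.Quotient.mk y) = Submodule.Quotient.mk (dualPerm σ y) :=
  rfl

lemma inducedByPerm_discPerm (σ : Equiv.Perm (Fin 5)) : InducedByPerm σ (discPerm σ) :=
  fun y => ⟨dualPerm σ y, rfl, discPerm_mk σ y⟩

lemma preservesQ_discPerm (σ : Equiv.Perm (Fin 5)) : PreservesQ (discPerm σ) :=
  fun y => ⟨dualPerm σ y, (discPerm_mk σ y).symm, 0, by
    rw [Int.cast_zero, mul_zero, sub_eq_zero]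
    exact gq_comp_extPerm σ y⟩

/-- The vector `(∑ j ≠ i, eⱼ) / 2` of `M*`. -/
def halfVec (i : Fin 5) : dualL Mgram :=
  ⟨Fin.cons 0 fun j => if j = i then 0 else 1 / 2, mem_dualL_Mgram.2
    ⟨0, 2, fun j => if j = i then 0 else 1, by simp, fun j => by
      by_cases h : j = i <;> simp [h], by
      revert i; decide⟩⟩

@[simp] lemma halfVec_zero (i : Fin 5) : (halfVec i : Fin 6 → ℚ) 0 = 0 := rfl

@[simp] lemma halfVec_succ (i j : Fin 5) :
    (halfVec i : Fin 6 → ℚ) j.succ = if j = i then 0 else 1 / 2 := rfl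

/-- The class in `A_M` of `(∑ j ≠ i, eⱼ) / 2`. -/
def halfClass (i : Fin 5) : AM := Submodule.Quotient.mk (halfVec i)

lemma half_ne_intCast (m : ℤ) : (1 / 2 : ℚ) ≠ m := by
  intro h
  have h2 : (1 : ℚ) = ((2 * m : ℤ) : ℚ) := by
    push_cast
    linarith
  have : (1 : ℤ) = 2 * m := by exact_mod_cast h2
  omega

lemma halfClass_injective : Function.Injective halfClass := by
  intro i j h
  by_contra hij
  obtain ⟨m, hm⟩ := AM_mk_eq_mk.1 h j.succ
  simp only [halfVec_succ, if_true, if_neg (Ne.symm hij), sub_zero] at hm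
  exact half_ne_intCast m hm

lemma halfClass_ne_zero (i : Fin 5) : halfClass i ≠ 0 := by
  intro h
  obtain ⟨j, hj⟩ := exists_ne i
  obtain ⟨m, hm⟩ := (AM_mk_eq_mk (z := 0)).1 h j.succ
  simp only [halfVec_succ, if_neg hj, Submodule.coe_zero, Pi.zero_apply, sub_zero] at hm
  exact half_ne_intCast m hm

lemma AM_mk_eq_sum_halfClass (y : dualL Mgram) :
    ∃ b : Fin 5 → ℤ, (Submodule.Quotient.mk y : AM) = ∑ i, b i • halfClass i := by
  obtain ⟨a, c, b, ha, hb, hc⟩ := mem_dualL_Mgram.1 y.2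
  refine ⟨b, ?_⟩
  have hsum : ∑ i, b i • halfClass i =
      (Submodule.Quotient.mk (∑ i, b i • halfVec i) : AM) := by
    simp only [halfClass, ← Submodule.mkQ_apply, map_sum, map_zsmul]
  have hc' : ∑ i, (b i : ℚ) = 2 * c := by exact_mod_cast hc
  rw [hsum, AM_mk_eq_mk]
  refine Fin.cases ⟨a, ?_⟩ fun j => ⟨b j - c, ?_⟩
  · simp [ha]
  · have hj : ∑ i, (b i : ℚ) * (if j = i then 0 else 1 / 2) = c - b j / 2 := by
      have (i : Fin 5) : (b i : ℚ) * (if j = i then 0 else 1 / 2) =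
          b i / 2 - if j = i then (b i : ℚ) / 2 else 0 := by
        split_ifs <;> ring
      simp only [this, Finset.sum_sub_distrib, ← Finset.sum_div, hc']
      simp
    simp only [AddSubmonoidClass.coe_finsetSum, Finset.sum_apply, Submodule.coe_smul,
      Pi.smul_apply, ← Int.cast_smul_eq_zsmul ℚ, smul_eq_mul, halfVec_succ, hj, hb]
    push_cast
    ring

lemma AM_addEquiv_ext {τ τ' : AM ≃+ AM} (h : ∀ i, τ (halfClass i) = τ' (halfClass i)) :
    τ = τ' := by
  ext x
  obtain ⟨y, rfl⟩ := Submodule.Quotient.mk_surjective _ x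
  obtain ⟨b, hb⟩ := AM_mk_eq_sum_halfClass y
  simp only [hb, map_sum, map_zsmul, h]

lemma InducedByPerm.apply_halfClass {σ : Equiv.Perm (Fin 5)} {τ : AM ≃+ AM}
    (h : InducedByPerm σ τ) (i : Fin 5) : τ (halfClass i) = halfClass (σ.symm i) := by
  obtain ⟨z, hz, hτ⟩ := h (halfVec i)
  rw [halfClass, hτ, halfClass]
  congr 1
  ext j
  rw [hz]
  refine Fin.cases ?_ (fun j => ?_) j
  · simp
  · simp [Equiv.eq_symm_apply]

lemma sq_emod_four (n : ℤ) : n ^ 2 % 4 = n % 2 := by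
  obtain ⟨k, rfl | rfl⟩ := Int.even_or_odd' n
  · ring_nf
    omega
  · ring_nf
    omega

lemma even_or_exists_of_sum_sq (b : Fin 5 → ℤ) (h : 4 ∣ ∑ i, b i ^ 2) :
    (∀ i, 2 ∣ b i) ∨ ∃ j, ∀ i, 2 ∣ b i - if i = j then 0 else 1 := by
  have key : ∀ r : Fin 5 → Bool, (4 : ℤ) ∣ ∑ i, ((r i).toNat : ℤ) →
      (∀ i, r i = false) ∨ ∃ j, ∀ i, r i = !decide (i = j) := by decide
  have hr (i : Fin 5) : (((decide (b i % 2 = 1)).toNat : ℕ) : ℤ) = b i % 2 := by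
    rcases Int.emod_two_eq (b i) with h | h <;> simp [h]
  have hsum : (4 : ℤ) ∣ ∑ i, b i % 2 := by
    have hd : (4 : ℤ) ∣ ∑ i, (b i ^ 2 - b i % 2) := Finset.dvd_sum fun i _ =>
      sq_emod_four (b i) ▸ Int.dvd_self_sub_emod
    rw [Finset.sum_sub_distrib] at hd
    exact (dvd_sub_right h).1 hd
  refine (key (fun i => decide (b i % 2 = 1)) (by simpa only [hr] using hsum)).imp
    (fun h i => ?_) fun ⟨j, h⟩ => ⟨j, fun i => ?_⟩
  · have := h i
    simp only [decide_eq_false_iff_not] at this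
    omega
  · have := h i
    by_cases hij : i = j <;> simp [hij] at this ⊢ <;> omega

lemma mk_eq_zero_or_halfClass {z : dualL Mgram}
    (hz : ∃ m : ℤ, gq Mgram (z : Fin 6 → ℚ) (z : Fin 6 → ℚ) = 2 * m) :
    (Submodule.Quotient.mk z : AM) = 0 ∨ ∃ j, (Submodule.Quotient.mk z : AM) = halfClass j := by
  obtain ⟨m, hm⟩ := hz
  obtain ⟨a, c, b, ha, hb, hc⟩ := mem_dualL_Mgram.1 z.2
  have hc' : ∑ i, (b i : ℚ) = 2 * c := by exact_mod_cast hc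
  have hsq : ∑ i, b i ^ 2 = 4 * (a * c - a ^ 2 - m) := by
    have : ∑ i : Fin 5, (b i / 2 : ℚ) * (a - 2 * (b i / 2)) =
        a * c - (∑ i, (b i : ℚ) ^ 2) / 2 := by
      have (i : Fin 5) : (b i / 2 : ℚ) * (a - 2 * (b i / 2)) = a / 2 * b i - b i ^ 2 / 2 := by
        ring
      simp only [this, Finset.sum_sub_distrib, ← Finset.mul_sum, ← Finset.sum_div, hc']
      ring
    simp only [gq_Mgram, ha, hb, this, ← Finset.sum_div, hc'] at hm
    have : ∑ i, (b i : ℚ) ^ 2 = 4 * (a * c - a ^ 2 - m) := by linarith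
    exact_mod_cast this
  refine (even_or_exists_of_sum_sq b ⟨_, hsq⟩).imp (fun h => ?_) fun ⟨j, h⟩ => ⟨j, ?_⟩
  · refine (AM_mk_eq_mk (z := 0)).2 (Fin.cases ⟨a, by simp [ha]⟩ fun i => ?_)
    obtain ⟨k, hk⟩ := h i
    exact ⟨k, by simp [hb, hk]⟩
  · refine AM_mk_eq_mk.2 (Fin.cases ⟨a, by simp [ha]⟩ fun i => ?_)
    obtain ⟨k, hk⟩ := h i
    refine ⟨k, ?_⟩
    rw [hb, halfVec_succ, eq_add_of_sub_eq hk]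
    split_ifs <;> push_cast <;> ring

lemma gq_halfVec (i : Fin 5) :
    gq Mgram (halfVec i : Fin 6 → ℚ) (halfVec i : Fin 6 → ℚ) = -2 := by
  rw [gq_Mgram]
  have (j : Fin 5) : (if j = i then (0 : ℚ) else 1 / 2) * (0 - 2 * if j = i then 0 else 1 / 2) =
      -1 / 2 + if j = i then 1 / 2 else 0 := by
    split_ifs <;> norm_num
  simp only [halfVec_zero, halfVec_succ, this, Finset.sum_add_distrib]
  simp
  norm_num

lemma PreservesQ.exists_apply_halfClass {τ : AM ≃+ AM} (h : PreservesQ τ) (i : Fin 5) :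
    ∃ j, τ (halfClass i) = halfClass j := by
  obtain ⟨z, hz, m, hm⟩ := h (halfVec i)
  rw [gq_halfVec] at hm
  change _ = τ (halfClass i) at hz
  rw [← hz]
  refine (mk_eq_zero_or_halfClass ⟨m - 1, by push_cast; linarith⟩).resolve_left fun h0 => ?_
  rw [hz, EmbeddingLike.map_eq_zero_iff] at h0
  exact halfClass_ne_zero i h0

/-- The composition `Σ₅ → O(M) → O(q_M)` is an isomorphism: every permutation
of `e₁, …, e₅` induces an automorphism of `A_M` preserving `q_M`, and every
automorphism of `A_M` preserving `q_M` is induced by a unique permutation. -/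
theorem sigma5_iso_OqM :
    (∀ σ : Equiv.Perm (Fin 5), ∃ τ : AM ≃+ AM, PreservesQ τ ∧ InducedByPerm σ τ) ∧
    (∀ τ : AM ≃+ AM, PreservesQ τ → ∃! σ : Equiv.Perm (Fin 5), InducedByPerm σ τ) := by
  refine ⟨fun σ => ⟨discPerm σ, preservesQ_discPerm σ, inducedByPerm_discPerm σ⟩,
    fun τ hτ => ?_⟩
  choose p hp using hτ.exists_apply_halfClass
  have hinj : Function.Injective p := fun i j hij =>
    halfClass_injective (τ.injective (by rw [hp, hp, hij]))
  let π : Equiv.Perm (Fin 5) := Equiv.ofBijective p (Finite.injective_iff_bijective.1 hinj)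
  have hπ : τ = discPerm π.symm := AM_addEquiv_ext fun i => by
    rw [(inducedByPerm_discPerm π.symm).apply_halfClass, hp]
    rfl
  refine ⟨π.symm, by simpa only [hπ] using inducedByPerm_discPerm π.symm, fun σ hσ => ?_⟩
  rw [← Equiv.symm_symm σ]
  congr 1
  ext i
  congr 1
  apply halfClass_injective
  rw [← hσ.apply_halfClass, hp]
  rfl
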